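/- arXiv:1501.02444 — 2 statements merged into one kernel-verified Lean document; each statement's English description precedes it below -/
import Mathlib

section
/- Let z, z' ∈ (0,1) with z ≤ z', and let S be any finite set of binary strings of length n. Then ∑_{b ∈ S} F_b(z) ≤ (∑_{b ∈ S} F_b(z'))^η, where η = (log z)/(log z'). (In coding terms: for a fixed polar code with information set S designed for the binary erasure channel with erasure probability z', the sum of the Bhattacharyya parameters at the information positions for a better erasure channel z ≤ z' is at most the corresponding sum for z' raised to the power η; hence polar codes over the BEC exhibit no error floor.) -/
/-- One polarization step for the Bhattacharyya parameter of a BEC. -/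
noncomputable def becStep (z : ℝ) (b : Bool) : ℝ := if b then z ^ 2 else 2 * z - z ^ 2

/-- `becF n b z` is the Bhattacharyya parameter of the synthetic channel indexed by the
binary string `b` obtained by polarizing a BEC with erasure probability `z`. -/
noncomputable def becF (n : ℕ) (b : Fin n → Bool) (z : ℝ) : ℝ :=
  (List.ofFn b).foldl becStep z

lemma becStep_mem (z : ℝ) (b : Bool) (h0 : 0 ≤ z) (h1 : z ≤ 1) :
    0 ≤ becStep z b ∧ becStep z b ≤ 1 := by
  cases b <;> simp only [becStep, if_true, Bool.false_eq_true, if_false] <;>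
    constructor <;> nlinarith

lemma two_le_rpow_add (x p : ℝ) (h0 : 0 ≤ x) (h1 : x ≤ 1) (hp : 1 ≤ p) :
    2 ≤ (2 - x) ^ p + x ^ p := by
  have h := (convexOn_rpow hp).2 (Set.mem_Ici.2 (by linarith : (0:ℝ) ≤ 2 - x)) (Set.mem_Ici.2 h0)
    (by norm_num : (0:ℝ) ≤ 1 / 2) (by norm_num : (0:ℝ) ≤ 1 / 2) (by norm_num)
  simp only [smul_eq_mul] at h
  have e : (1 / 2 : ℝ) * (2 - x) + 1 / 2 * x = 1 := by ring
  rw [e, Real.one_rpow] at h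
  linarith

lemma becStep_rpow (z w p : ℝ) (b : Bool) (hp : 1 ≤ p) (hz0 : 0 ≤ z)
    (hw0 : 0 ≤ w) (hw1 : w ≤ 1) (h : z ≤ w ^ p) :
    becStep z b ≤ (becStep w b) ^ p := by
  have hq0 : 0 ≤ w ^ p := Real.rpow_nonneg hw0 p
  have hq1 : w ^ p ≤ 1 := Real.rpow_le_one hw0 hw1 (by linarith)
  cases b
  · have e : (becStep w false) ^ p = w ^ p * (2 - w) ^ p := by
      rw [← Real.mul_rpow hw0 (by linarith)]
      congr 1
      simp [becStep]
      ring
    rw [e]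
    have h2 := two_le_rpow_add w p hw0 hw1 hp
    have h3 : w ^ p * (2 - w ^ p) ≤ w ^ p * (2 - w) ^ p :=
      mul_le_mul_of_nonneg_left (by linarith) hq0
    simp only [becStep]
    norm_num
    nlinarith
  · have e : (becStep w true) ^ p = (w ^ p) ^ 2 := by
      simp only [becStep, if_true]
      rw [sq, sq, Real.mul_rpow hw0 hw0]
    rw [e]
    simp only [becStep, if_true]
    gcongr

lemma foldl_becStep_rpow (l : List Bool) (p : ℝ) (hp : 1 ≤ p) : ∀ (z w : ℝ), 0 ≤ z → z ≤ 1 →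
    0 ≤ w → w ≤ 1 → z ≤ w ^ p →
    l.foldl becStep z ≤ (l.foldl becStep w) ^ p ∧ 0 ≤ l.foldl becStep w := by
  induction l with
  | nil => intro z w _ _ hw _ h; exact ⟨h, hw⟩
  | cons b l ih =>
    intro z w hz0 hz1 hw0 hw1 h
    have a := becStep_mem z b hz0 hz1
    have c := becStep_mem w b hw0 hw1
    exact ih _ _ a.1 a.2 c.1 c.2 (becStep_rpow z w p b hp hz0 hw0 hw1 h)

lemma sum_rpow_le_rpow_sum {ι : Type*} (S : Finset ι) (f : ι → ℝ) (p : ℝ) (hp : 1 ≤ p)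
    (hf : ∀ i, 0 ≤ f i) : ∑ i ∈ S, f i ^ p ≤ (∑ i ∈ S, f i) ^ p := by
  classical
  induction S using Finset.induction_on with
  | empty => simp [Real.zero_rpow (by linarith : p ≠ 0)]
  | insert a s ha ih =>
    rw [Finset.sum_insert ha, Finset.sum_insert ha]
    have := Real.add_rpow_le_rpow_add (hf a) (Finset.sum_nonneg (s := s) fun i _ => hf i) hp
    linarith

/-- **Absence of error floors for polar codes over the BEC.**
For `z ≤ z'` in `(0,1)`, every `n` and every finite set `S` of binary strings of
length `n` (the information set of a fixed polar code designed for erasure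
probability `z'`), the sum of the Bhattacharyya parameters over `S` for the better
channel `z` is at most the corresponding sum for `z'` raised to the power
`η = (log z)/(log z')`. -/
theorem bec_no_error_floor
    (z z' : ℝ) (hz : z ∈ Set.Ioo (0:ℝ) 1) (hz' : z' ∈ Set.Ioo (0:ℝ) 1)
    (hle : z ≤ z') (n : ℕ) (S : Finset (Fin n → Bool)) :
    ∑ b ∈ S, becF n b z ≤ (∑ b ∈ S, becF n b z') ^ (Real.log z / Real.log z') := by
  obtain ⟨hz0, hz1⟩ := hz
  obtain ⟨hw0, hw1⟩ := hz'
  have hlw : Real.log z' < 0 := Real.log_neg hw0 hw1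
  have hp : 1 ≤ Real.log z / Real.log z' := by
    rw [le_div_iff_of_neg hlw, one_mul]
    exact Real.log_le_log hz0 hle
  have hzp : z ≤ z' ^ (Real.log z / Real.log z') := by
    rw [Real.rpow_def_of_pos hw0, mul_div_cancel₀ _ hlw.ne, Real.exp_log hz0]
  have key : ∀ b : Fin n → Bool, becF n b z ≤ (becF n b z') ^ (Real.log z / Real.log z') ∧
      0 ≤ becF n b z' := fun b =>
    foldl_becStep_rpow _ _ hp z z' hz0.le hz1.le hw0.le hw1.le hzp
  exact (Finset.sum_le_sum fun b _ => (key b).1).trans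
    (sum_rpow_le_rpow_sum S _ _ hp fun b => (key b).2)
end

section
/- Let z ∈ [0,1] and let (Z_n) be the BEC Bhattacharyya process with initial value z. Let α ∈ (0,1), let ρ ≤ 1/2, let p_e ∈ (0,1), and let c₁ > 0. Assume that for every n ≥ 1, E[(Z_n(1 − Z_n))^α] ≤ c₁·2^(−nρ). Then for every n ≥ 1, P(Z_n ≤ p_e·2^(−n)) ≥ (1 − z) − c₂·2^(−n(ρ−α)), where c₂ = √(2 p_e) + 2 c₁ p_e^(−α). -/
open scoped Classical

theorem becStep_mem_s5 (z : ℝ) (hz : z ∈ Set.Icc (0:ℝ) 1) (b : Bool) :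
    becStep z b ∈ Set.Icc (0:ℝ) 1 := by
  obtain ⟨h0, h1⟩ := hz
  unfold becStep
  split_ifs <;> constructor <;> nlinarith

theorem becF_succ (n : ℕ) (b : Fin (n+1) → Bool) (z : ℝ) :
    becF (n+1) b z = becF n (fun i => b i.succ) (becStep z (b 0)) := by
  simp [becF, List.ofFn_succ]

theorem becF_mem (n : ℕ) : ∀ (b : Fin n → Bool) (z : ℝ), z ∈ Set.Icc (0:ℝ) 1 →
    becF n b z ∈ Set.Icc (0:ℝ) 1 := by
  induction n with
  | zero => intro b z hz; simpa [becF] using hz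
  | succ n ih =>
    intro b z hz
    rw [becF_succ]
    exact ih _ _ (becStep_mem_s5 z hz _)

theorem becF_sum (n : ℕ) : ∀ z : ℝ, ∑ b : Fin n → Bool, becF n b z = 2 ^ n * z := by
  induction n with
  | zero => intro z; simp [becF]
  | succ n ih =>
    intro z
    rw [← (Fin.consEquiv (fun _ : Fin (n+1) => Bool)).sum_comp, Fintype.sum_prod_type]
    simp only [becF_succ, Fin.consEquiv_apply, Fin.cons_zero, Fin.cons_succ, ih,
      Fintype.sum_bool]
    simp [becStep]
    ring

theorem bec_pointwise (x t α : ℝ) (hx : x ∈ Set.Icc (0:ℝ) 1) (ht : 0 < t) (ht' : t ≤ 1/2)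
    (hα : α ∈ Set.Ioo (0:ℝ) 1) :
    1 ≤ (if x ≤ t then (1:ℝ) else 0) + x + t + 2 * t ^ (-α) * (x * (1 - x)) ^ α := by
  obtain ⟨h0, h1⟩ := hx
  have hxx : 0 ≤ x * (1 - x) := mul_nonneg h0 (by linarith)
  have hp : 0 ≤ 2 * t ^ (-α) * (x * (1 - x)) ^ α := by positivity
  split_ifs with h
  · linarith
  · push Not at h
    by_cases h2 : 1 - t ≤ x
    · linarith
    · push Not at h2
      have h3 : t * (1/2) ≤ x * (1 - x) := by nlinarith
      have h4 : (t * (1/2)) ^ α ≤ (x * (1 - x)) ^ α :=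
        Real.rpow_le_rpow (by positivity) h3 hα.1.le
      rw [Real.mul_rpow ht.le (by norm_num)] at h4
      have h5 : (1/2 : ℝ) ≤ (1/2 : ℝ) ^ α := by
        have := Real.rpow_le_rpow_of_exponent_ge (x := (1/2:ℝ)) (by norm_num) (by norm_num) hα.2.le
        simpa using this
      have h6 : t ^ (-α) * t ^ α = 1 := by
        rw [← Real.rpow_add ht]; simp
      have h7 : 0 < t ^ (-α) := by positivity
      have h8 : 0 < t ^ α := by positivity
      have h9 : t ^ α * (1/2) ≤ (x * (1 - x)) ^ α := by nlinarith
      nlinarith [mul_le_mul_of_nonneg_left h9 h7.le]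

/-- **From expectation to scaling exponent (BEC).**
Let `(Z_n)` be the BEC Bhattacharyya process with initial value `z ∈ [0,1]`.  If for
every `n ≥ 1` one has `E[(Z_n(1 − Z_n))^α] ≤ c₁·2^(−nρ)` for some `α ∈ (0,1)` and
`ρ ≤ 1/2`, then for every `n ≥ 1`,
`P(Z_n ≤ p_e·2^(−n)) ≥ (1 − z) − c₂·2^(−n(ρ−α))` with
`c₂ = √(2 p_e) + 2 c₁ p_e^(−α)`.  Expectations and probabilities are uniform
averages over the `2^n` binary strings of length `n`. -/
theorem bec_expectation_to_scaling
    (z : ℝ) (hz : z ∈ Set.Icc (0:ℝ) 1)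
    (α : ℝ) (hα : α ∈ Set.Ioo (0:ℝ) 1)
    (ρ : ℝ) (hρ : ρ ≤ 1/2)
    (pe : ℝ) (hpe : pe ∈ Set.Ioo (0:ℝ) 1)
    (c₁ : ℝ) (hc₁ : 0 < c₁)
    (hE : ∀ n : ℕ, 1 ≤ n →
      (∑ b : Fin n → Bool, (becF n b z * (1 - becF n b z)) ^ α) / 2 ^ n
        ≤ c₁ * (2:ℝ) ^ (-(n:ℝ) * ρ)) :
    ∀ n : ℕ, 1 ≤ n →
      (1 - z) - (Real.sqrt (2 * pe) + 2 * c₁ * pe ^ (-α)) * (2:ℝ) ^ (-(n:ℝ) * (ρ - α)) ≤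
        ((Finset.univ.filter
            (fun b : Fin n → Bool => becF n b z ≤ pe * (2:ℝ) ^ (-(n:ℝ)))).card : ℝ)
          / 2 ^ n := by
  intro n hn
  obtain ⟨hp0, hp1⟩ := hpe
  have hn1 : (1:ℝ) ≤ n := by exact_mod_cast hn
  set t : ℝ := pe * (2:ℝ) ^ (-(n:ℝ)) with ht
  have h2n : (2:ℝ) ^ (-(n:ℝ)) ≤ 1/2 := by
    have := Real.rpow_le_rpow_of_exponent_le (x := (2:ℝ)) (by norm_num)
      (show -(n:ℝ) ≤ -1 by linarith)
    rw [Real.rpow_neg_one] at this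
    linarith
  have h2p : 0 < (2:ℝ) ^ (-(n:ℝ)) := by positivity
  have ht0 : 0 < t := by positivity
  have ht1 : t ≤ 1/2 := by nlinarith
  have hsum := Finset.sum_le_sum (s := Finset.univ) (fun (b : Fin n → Bool) _ =>
    bec_pointwise (becF n b z) t α (becF_mem n b z hz) ht0 ht1 hα)
  simp only [Finset.sum_add_distrib, ← Finset.mul_sum, becF_sum, Finset.sum_boole] at hsum
  simp only [Finset.sum_const, Finset.card_univ, Fintype.card_fun, Fintype.card_bool,
    Fintype.card_fin, nsmul_eq_mul, mul_one] at hsum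
  push_cast at hsum
  have hEn := hE n hn
  set S := ∑ b : Fin n → Bool, (becF n b z * (1 - becF n b z)) ^ α
  set N : ℝ := 2 ^ n with hN
  have hN0 : 0 < N := by positivity
  rw [div_le_iff₀ hN0] at hEn
  rw [le_div_iff₀ hN0]
  have hta : t ^ (-α) = pe ^ (-α) * (2:ℝ) ^ ((n:ℝ) * α) := by
    rw [ht, Real.mul_rpow hp0.le h2p.le, ← Real.rpow_mul (by norm_num)]
    congr 2; ring
  have hsplit : (2:ℝ) ^ (-(n:ℝ) * (ρ - α)) = (2:ℝ) ^ ((n:ℝ) * α) * (2:ℝ) ^ (-(n:ℝ) * ρ) := by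
    rw [← Real.rpow_add (by norm_num)]
    congr 1; ring
  have hexp : (2:ℝ) ^ (-(n:ℝ)) ≤ (2:ℝ) ^ (-(n:ℝ) * (ρ - α)) := by
    apply Real.rpow_le_rpow_of_exponent_le (by norm_num)
    nlinarith [hα.1]
  have hsq : pe ≤ Real.sqrt (2 * pe) := by
    apply Real.le_sqrt_of_sq_le
    nlinarith
  have htb : t ≤ Real.sqrt (2 * pe) * (2:ℝ) ^ (-(n:ℝ) * (ρ - α)) :=
    mul_le_mul hsq hexp h2p.le (Real.sqrt_nonneg _)
  have hS : 2 * t ^ (-α) * S ≤ 2 * c₁ * pe ^ (-α) * (2:ℝ) ^ (-(n:ℝ) * (ρ - α)) * N := by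
    calc 2 * t ^ (-α) * S ≤ 2 * t ^ (-α) * (c₁ * (2:ℝ) ^ (-(n:ℝ) * ρ) * N) :=
          mul_le_mul_of_nonneg_left hEn (by positivity)
      _ = _ := by rw [hta, hsplit]; ring
  have htN := mul_le_mul_of_nonneg_right htb hN0.le
  nlinarith [hsum, hS, htN]
end
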